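/- Let A be a finite set. Every maximal congruence ∼ on the free B₁-algebra B₁[A] is of the form ∼_I for some subset I ⊆ A, namely I = {x ∈ A : {δ_x} ∼ 0}; in particular, every quotient of B₁[A] by a maximal congruence is isomorphic to B₁ (has exactly two elements). -/

import Mathlib

/-- Minkowski product on finite subsets of `ℕ^A`: `R·S = {a + b : a ∈ R, b ∈ S}`. -/
def mink {A : Type} [Fintype A] (R S : Finset (A → ℕ)) : Finset (A → ℕ) :=
  (R ×ˢ S).image fun p => p.1 + p.2

/-- The indicator `δ_x ∈ ℕ^A` of `x ∈ A`. -/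
def delta {A : Type} [DecidableEq A] (x : A) : A → ℕ :=
  fun b => if b = x then 1 else 0

/-- A congruence on the free `B₁`-algebra `B₁[A] = 𝒫_f(ℕ^A)` (with union as addition
and Minkowski product as multiplication): an equivalence relation compatible with both
operations, with `0 = ∅` not congruent to `1 = {0}`. -/
def IsMinkCongr {A : Type} [Fintype A]
    (r : Finset (A → ℕ) → Finset (A → ℕ) → Prop) : Prop :=
  Equivalence r ∧
  (∀ R S R' S' : Finset (A → ℕ), r R S → r R' S' → r (R ∪ R') (S ∪ S')) ∧
  (∀ R S R' S' : Finset (A → ℕ), r R S → r R' S' → r (mink R R') (mink S S')) ∧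
  ¬ r ∅ {(0 : A → ℕ)}

/-- A maximal congruence: any congruence containing it equals it. -/
def IsMaximalMinkCongr {A : Type} [Fintype A]
    (r : Finset (A → ℕ) → Finset (A → ℕ) → Prop) : Prop :=
  IsMinkCongr r ∧
  ∀ r' : Finset (A → ℕ) → Finset (A → ℕ) → Prop,
    IsMinkCongr r' → (∀ R S, r R S → r' R S) → r' = r

/-- `F_I(R) = {r ∈ R : r(x) = 0 for all x ∈ I}`. -/
def FI {A : Type} [Fintype A] (I : Finset A) (R : Finset (A → ℕ)) : Finset (A → ℕ) :=
  R.filter fun r => ∀ x ∈ I, r x = 0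

/-- `R ∼_I S` iff `F_I(R)` and `F_I(S)` are both empty or both nonempty. -/
def simI {A : Type} [Fintype A] (I : Finset A) (R S : Finset (A → ℕ)) : Prop :=
  (FI I R = ∅ ∧ FI I S = ∅) ∨ (FI I R ≠ ∅ ∧ FI I S ≠ ∅)

open scoped Pointwise

section MinkCongr

variable {A : Type} [Fintype A]

theorem mink_eq_add (R S : Finset (A → ℕ)) : mink R S = R + S := rfl

theorem FI_eq_empty_iff (I : Finset A) (R : Finset (A → ℕ)) :
    FI I R = ∅ ↔ ∀ a ∈ R, ¬ ∀ x ∈ I, a x = 0 :=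
  Finset.filter_eq_empty_iff

/-- An ideal of `B₁[A]`, closed downwards for the order of the quotient by `r`. -/
structure IsLowerIdeal (r : Finset (A → ℕ) → Finset (A → ℕ) → Prop)
    (P : Set (Finset (A → ℕ))) : Prop where
  empty_mem : ∅ ∈ P
  union_mem : ∀ R ∈ P, ∀ S ∈ P, R ∪ S ∈ P
  add_mem : ∀ R ∈ P, ∀ S, R + S ∈ P
  mem_of_le : ∀ S ∈ P, ∀ R, r (R ∪ S) S → R ∈ P

variable {r : Finset (A → ℕ) → Finset (A → ℕ) → Prop} {P : Set (Finset (A → ℕ))}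

theorem IsMinkCongr.add (hr : IsMinkCongr r) {R S R' S' : Finset (A → ℕ)}
    (h : r R S) (h' : r R' S') : r (R + R') (S + S') :=
  hr.2.2.1 _ _ _ _ h h'

theorem IsMinkCongr.le_trans (hr : IsMinkCongr r) {R S T : Finset (A → ℕ)}
    (h : r (R ∪ S) S) (h' : r (S ∪ T) T) : r (R ∪ T) T := by
  have h₁ : r (R ∪ (S ∪ T)) (R ∪ T) := hr.2.1 _ _ _ _ (hr.1.refl R) h'
  have h₂ : r (R ∪ S ∪ T) (S ∪ T) := hr.2.1 _ _ _ _ h (hr.1.refl T)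
  rw [← Finset.union_assoc] at h₁
  exact hr.1.trans (hr.1.symm h₁) (hr.1.trans h₂ h')

theorem IsMinkCongr.le_of_subset (hr : IsMinkCongr r) {R S : Finset (A → ℕ)} (h : R ⊆ S) :
    r (R ∪ S) S := by
  rw [Finset.union_eq_right.2 h]
  exact hr.1.refl S

/-- The lower ideal generated by a lower ideal `P` and an element `R`. -/
def lowerIdealInsert (r : Finset (A → ℕ) → Finset (A → ℕ) → Prop)
    (P : Set (Finset (A → ℕ))) (R : Finset (A → ℕ)) : Set (Finset (A → ℕ)) :=
  {T | ∃ S ∈ P, ∃ Q, r (T ∪ (S ∪ (R + Q))) (S ∪ (R + Q))}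

theorem IsLowerIdeal.insert (hr : IsMinkCongr r) (hP : IsLowerIdeal r P)
    (R : Finset (A → ℕ)) : IsLowerIdeal r (lowerIdealInsert r P R) where
  empty_mem := ⟨∅, hP.empty_mem, ∅, hr.le_of_subset (Finset.empty_subset _)⟩
  union_mem := by
    rintro T ⟨S, hS, Q, h⟩ T' ⟨S', hS', Q', h'⟩
    refine ⟨S ∪ S', hP.union_mem S hS S' hS', Q ∪ Q', ?_⟩
    have := hr.2.1 _ _ _ _ h h'
    rw [Finset.add_union, Finset.union_union_union_comm S S' (R + Q) (R + Q'),
      Finset.union_union_union_comm T T']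
    exact this
  add_mem := by
    rintro T ⟨S, hS, Q, h⟩ T'
    refine ⟨S + T', hP.add_mem S hS T', Q + T', ?_⟩
    have := hr.add h (hr.1.refl T')
    simpa only [Finset.union_add, add_assoc] using this
  mem_of_le := by
    rintro T ⟨S, hS, Q, h⟩ T' h'
    exact ⟨S, hS, Q, hr.le_trans h' h⟩

theorem IsLowerIdeal.mem_of_subset (hr : IsMinkCongr r) (hP : IsLowerIdeal r P)
    {R S : Finset (A → ℕ)} (h : R ⊆ S) (hS : S ∈ P) : R ∈ P :=
  hP.mem_of_le S hS R (hr.le_of_subset h)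

theorem IsLowerIdeal.union_mem_iff (hr : IsMinkCongr r) (hP : IsLowerIdeal r P)
    {R S : Finset (A → ℕ)} : R ∪ S ∈ P ↔ R ∈ P ∧ S ∈ P :=
  ⟨fun h => ⟨hP.mem_of_subset hr Finset.subset_union_left h,
    hP.mem_of_subset hr Finset.subset_union_right h⟩, fun h => hP.union_mem R h.1 S h.2⟩

theorem IsLowerIdeal.mem_iff_singleton_mem (hr : IsMinkCongr r) (hP : IsLowerIdeal r P)
    (R : Finset (A → ℕ)) : R ∈ P ↔ ∀ a ∈ R, {a} ∈ P := by
  induction R using Finset.induction_on with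
  | empty => simpa using hP.empty_mem
  | insert a R _ ih =>
    rw [Finset.insert_eq, hP.union_mem_iff hr, ih]
    simp

/-- A lower ideal maximal among the proper ones. -/
def IsMaximalLowerIdeal (r : Finset (A → ℕ) → Finset (A → ℕ) → Prop)
    (P : Set (Finset (A → ℕ))) : Prop :=
  Maximal (fun P => IsLowerIdeal r P ∧ 0 ∉ P) P

theorem IsMinkCongr.isLowerIdeal_zero_class (hr : IsMinkCongr r) :
    IsLowerIdeal r {R | r R ∅} where
  empty_mem := hr.1.refl ∅
  union_mem := fun R hR S hS => by
    have := hr.2.1 _ _ _ _ hR hS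
    simpa using this
  add_mem := fun R hR S => by
    have := hr.add hR (hr.1.refl S)
    simpa using this
  mem_of_le := fun S hS R h => by
    have h₁ := hr.2.1 _ _ _ _ (hr.1.refl R) hS
    rw [Finset.union_empty] at h₁
    exact hr.1.trans (hr.1.symm h₁) (hr.1.trans h hS)

theorem IsMinkCongr.exists_isMaximalLowerIdeal (hr : IsMinkCongr r) :
    ∃ P, IsMaximalLowerIdeal r P := by
  obtain ⟨P, -, hP⟩ := zorn_subset_nonempty {P | IsLowerIdeal r P ∧ 0 ∉ P} (by
    rintro c hc hchain ⟨P₀, hP₀⟩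
    refine ⟨⋃₀ c, ⟨⟨?_, ?_, ?_, ?_⟩, ?_⟩, fun s hs => Set.subset_sUnion_of_mem hs⟩
    · exact ⟨P₀, hP₀, (hc hP₀).1.empty_mem⟩
    · rintro R ⟨P, hP, hR⟩ S ⟨Q, hQ, hS⟩
      rcases hchain.total hP hQ with h | h
      · exact ⟨Q, hQ, (hc hQ).1.union_mem R (h hR) S hS⟩
      · exact ⟨P, hP, (hc hP).1.union_mem R hR S (h hS)⟩
    · rintro R ⟨P, hP, hR⟩ S
      exact ⟨P, hP, (hc hP).1.add_mem R hR S⟩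
    · rintro S ⟨P, hP, hS⟩ R h
      exact ⟨P, hP, (hc hP).1.mem_of_le S hS R h⟩
    · rintro ⟨P, hP, h⟩
      exact (hc hP).2 h) {R | r R ∅}
    ⟨hr.isLowerIdeal_zero_class, fun h => hr.2.2.2 (hr.1.symm h)⟩
  exact ⟨P, hP⟩

theorem IsMaximalLowerIdeal.add_mem_iff (hr : IsMinkCongr r) (hP : IsMaximalLowerIdeal r P)
    {R S : Finset (A → ℕ)} : R + S ∈ P ↔ R ∈ P ∨ S ∈ P := by
  have hI := hP.prop.1
  refine ⟨fun h => or_iff_not_imp_left.2 fun hR => ?_, ?_⟩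
  · have h0 : 0 ∈ lowerIdealInsert r P R := by
      by_contra h0
      have hle : P ≤ lowerIdealInsert r P R := fun T hT =>
        ⟨T, hT, ∅, hr.le_of_subset Finset.subset_union_left⟩
      refine hR (hP.2 ⟨hI.insert hr R, h0⟩ hle ⟨∅, hI.empty_mem, 0, ?_⟩)
      exact hr.le_of_subset (by simp)
    obtain ⟨T, hT, Q, hQ⟩ := h0
    have hS := hr.add hQ (hr.1.refl S)
    rw [Finset.union_add, zero_add] at hS
    refine hI.mem_of_le _ ?_ S hS
    rw [Finset.union_add, add_right_comm]
    exact hI.union_mem _ (hI.add_mem T hT S) _ (hI.add_mem _ h Q)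
  · rintro (h | h)
    · exact hI.add_mem R h S
    · rw [add_comm]
      exact hI.add_mem S h R

theorem IsMaximalLowerIdeal.isMinkCongr (hr : IsMinkCongr r) (hP : IsMaximalLowerIdeal r P) :
    IsMinkCongr fun R S => (R ∈ P ↔ S ∈ P) := by
  refine ⟨⟨fun _ => Iff.rfl, Iff.symm, Iff.trans⟩, fun R S R' S' h h' => ?_,
    fun R S R' S' h h' => ?_, fun h => hP.prop.2 (h.1 hP.prop.1.empty_mem)⟩
  · beta_reduce at *
    rw [hP.prop.1.union_mem_iff hr, hP.prop.1.union_mem_iff hr, h, h']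
  · beta_reduce at *
    rw [mink_eq_add, mink_eq_add, hP.add_mem_iff hr, hP.add_mem_iff hr, h, h']

theorem IsLowerIdeal.mem_of_rel (hr : IsMinkCongr r) (hP : IsLowerIdeal r P)
    {R S : Finset (A → ℕ)} (h : r R S) (hS : S ∈ P) : R ∈ P :=
  hP.mem_of_le S hS R (by simpa using hr.2.1 _ _ _ _ h (hr.1.refl S))

theorem IsMaximalLowerIdeal.singleton_mem_iff [DecidableEq A] (hr : IsMinkCongr r)
    (hP : IsMaximalLowerIdeal r P) (a : A → ℕ) :
    {a} ∈ P ↔ ∃ x, {delta x} ∈ P ∧ a x ≠ 0 := by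
  constructor
  · contrapose!
    intro h
    let M : AddSubmonoid (A → ℕ) :=
      { carrier := {b | ({b} : Finset (A → ℕ)) ∉ P}
        zero_mem' := hP.prop.2
        add_mem' := fun {b c} hb hc hbc => by
          rw [← Finset.singleton_add_singleton, hP.add_mem_iff hr] at hbc
          exact hbc.elim hb hc }
    have hsum : a = ∑ x, a x • delta x := by
      ext y
      simp [delta]
    have hM : ∑ x, a x • delta x ∈ M := by
      refine M.sum_mem fun x _ => ?_
      by_cases hx : {delta x} ∈ P
      · rw [h x hx, zero_smul]
        exact M.zero_mem
      · exact M.nsmul_mem hx _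
    rw [← hsum] at hM
    exact hM
  · rintro ⟨x, hx, hax⟩
    have : a = delta x + (a - delta x) := by
      ext y
      by_cases hy : y = x
      · subst hy
        simp [delta]
        omega
      · simp [delta, hy]
    rw [this, ← Finset.singleton_add_singleton]
    exact hP.prop.1.add_mem _ hx _

end MinkCongr

/-- Every maximal congruence `∼` on `B₁[A]` equals `∼_I` for `I = {x : {δ_x} ∼ 0}`;
in particular every quotient of `B₁[A]` by a maximal congruence is isomorphic to `B₁`
(every element is congruent to `0 = ∅` or to `1 = {0}`). -/
theorem stmt_13 (A : Type) [Fintype A] [DecidableEq A]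
    (r : Finset (A → ℕ) → Finset (A → ℕ) → Prop)
    (hr : IsMaximalMinkCongr r) :
    (∃ I : Finset A, (∀ x : A, x ∈ I ↔ r {delta x} ∅) ∧ r = simI I) ∧
    ∀ R : Finset (A → ℕ), r R ∅ ∨ r R {(0 : A → ℕ)} := by
  classical
  obtain ⟨hc, hmax⟩ := hr
  obtain ⟨P, hP⟩ := hc.exists_isMaximalLowerIdeal
  have hI := hP.prop.1
  have hrP : (fun R S => (R ∈ P ↔ S ∈ P)) = r := hmax _ (hP.isMinkCongr hc) fun R S h =>
    ⟨hI.mem_of_rel hc (hc.1.symm h), hI.mem_of_rel hc h⟩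
  have hone : {(0 : A → ℕ)} ∉ P := hP.prop.2
  have hempty := hI.empty_mem
  have hFI : ∀ R, R ∈ P ↔ FI (Finset.univ.filter fun x => {delta x} ∈ P) R = ∅ := fun R => by
    rw [hI.mem_iff_singleton_mem hc, FI_eq_empty_iff]
    refine forall₂_congr fun a _ => ?_
    rw [hP.singleton_mem_iff hc]
    simp
  refine ⟨⟨Finset.univ.filter fun x => {delta x} ∈ P, fun x => ?_, ?_⟩, fun R => ?_⟩
  · simp [← hrP, hempty]
  · rw [← hrP]
    ext R S
    rw [hFI R, hFI S, simI]
    exact iff_iff_and_or_not_and_not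
  · rw [← hrP]
    by_cases h : R ∈ P
    · exact Or.inl (iff_of_true h hempty)
    · exact Or.inr (iff_of_false h hone)
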